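/- arXiv:2304.03876 — 2 statements merged into one kernel-verified Lean document; each statement's English description precedes it below -/
import Mathlib

section
/- Let (X,d) be a metric space and let u, u_1, u_2, … be fuzzy sets in F¹_USC(X) such that the subspace ([u]_0, d) is separable. Then the following are equivalent: (i) u_n Γ-converges to u; (ii) [u_n]_α Kuratowski converges to [u]_α for Lebesgue-almost every α ∈ (0,1); (iii) [u_n]_α Kuratowski converges to [u]_α for all α ∈ (0,1) \ P(u); (iv) there is a dense subset P of (0,1) \ P(u) such that [u_n]_α Kuratowski converges to [u]_α for all α ∈ P; (v) there is a countable dense subset P of (0,1) \ P(u) such that [u_n]_α Kuratowski converges to [u]_α for all α ∈ P. -/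
open Set Filter Topology MeasureTheory
open scoped ENNReal NNReal

noncomputable section

/-- `sup_{a ∈ A} inf_{b ∈ B} ρ a b`, valued in `ℝ≥0∞`. -/
def hStar {Y : Type*} (ρ : Y → Y → ℝ≥0∞) (A B : Set Y) : ℝ≥0∞ :=
  ⨆ a ∈ A, ⨅ b ∈ B, ρ a b

/-- Hausdorff (extended) distance with respect to the distance `ρ`:
`H(A,B) = max (H*(A,B)) (H*(B,A))`. -/
def hDist {Y : Type*} (ρ : Y → Y → ℝ≥0∞) (A B : Set Y) : ℝ≥0∞ :=
  max (hStar ρ A B) (hStar ρ B A)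

/-- Kuratowski lower limit of a sequence of sets. -/
def KurLiminf {Y : Type*} [TopologicalSpace Y] (C : ℕ → Set Y) : Set Y :=
  {y | ∃ f : ℕ → Y, (∀ n, f n ∈ C n) ∧ Tendsto f atTop (𝓝 y)}

/-- Kuratowski upper limit of a sequence of sets. -/
def KurLimsup {Y : Type*} [TopologicalSpace Y] (C : ℕ → Set Y) : Set Y :=
  {y | ∃ φ : ℕ → ℕ, StrictMono φ ∧ ∃ f : ℕ → Y,
      (∀ k, f k ∈ C (φ k)) ∧ Tendsto f atTop (𝓝 y)}

/-- Kuratowski convergence of a sequence of sets to a set. -/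
def KurConv {Y : Type*} [TopologicalSpace Y] (C : ℕ → Set Y) (L : Set Y) : Prop :=
  KurLiminf C = L ∧ KurLimsup C = L

/-- A set `P` is dense in the set `S` (in particular `P ⊆ S`). -/
def DenseIn {Y : Type*} [TopologicalSpace Y] (P S : Set Y) : Prop :=
  P ⊆ S ∧ S ⊆ closure P

variable {X : Type*} [MetricSpace X]

/-- Hausdorff distance `H*` between subsets of the metric space `X`. -/
def HXstar (A B : Set X) : ℝ≥0∞ := hStar edist A B

/-- Hausdorff distance `H` between subsets of the metric space `X`. -/
def HXdist (A B : Set X) : ℝ≥0∞ := hDist edist A B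

/-- The metric `d̄` on `X × [0,1]` (modelled on `X × ℝ`):
`d̄((x,α),(y,β)) = d(x,y) + |α - β|`. -/
def dbar (p q : X × ℝ) : ℝ≥0∞ := edist p.1 q.1 + edist p.2 q.2

/-- `H*` for subsets of `(X × [0,1], d̄)`. -/
def HPstar (A B : Set (X × ℝ)) : ℝ≥0∞ := hStar dbar A B

/-- Hausdorff distance for subsets of `(X × [0,1], d̄)`. -/
def HPdist (A B : Set (X × ℝ)) : ℝ≥0∞ := hDist dbar A B

/-- The α-cut of a fuzzy set `u : X → ℝ`:  `[u]_α = {x | u x ≥ α}` for `α ≠ 0`, and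
`[u]_0 = closure {x | u x > 0}`. -/
def acut (u : X → ℝ) (α : ℝ) : Set X :=
  if α = 0 then closure {x | 0 < u x} else {x | α ≤ u x}

/-- The endograph of `u`: `{(x,t) ∈ X × [0,1] : u x ≥ t}`. -/
def endograph (u : X → ℝ) : Set (X × ℝ) :=
  {p : X × ℝ | p.2 ∈ Icc (0:ℝ) 1 ∧ p.2 ≤ u p.1}

/-- The sendograph of `u`: `end u ∩ ([u]_0 × [0,1])`. -/
def sendograph (u : X → ℝ) : Set (X × ℝ) :=
  endograph u ∩ ((acut u 0) ×ˢ (Icc (0:ℝ) 1))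

/-- `F¹_USC(X)`: normal upper semicontinuous fuzzy sets with values in `[0,1]`, i.e. all
α-cuts (`α ∈ [0,1]`) are nonempty and closed. -/
def FUSC (u : X → ℝ) : Prop :=
  (∀ x, u x ∈ Icc (0:ℝ) 1) ∧
    ∀ α ∈ Icc (0:ℝ) 1, (acut u α).Nonempty ∧ IsClosed (acut u α)

/-- `F¹_USCG(X)`: members of `F¹_USC(X)` whose α-cuts are compact for `α ∈ (0,1]`. -/
def FUSCG (u : X → ℝ) : Prop :=
  FUSC u ∧ ∀ α ∈ Ioc (0:ℝ) 1, IsCompact (acut u α)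

/-- `F¹_USCB(X)`: members of `F¹_USC(X)` whose 0-cut is compact. -/
def FUSCB (u : X → ℝ) : Prop :=
  FUSC u ∧ IsCompact (acut u 0)

/-- The endograph metric `H_end`. -/
def Hend (u v : X → ℝ) : ℝ≥0∞ := HPdist (endograph u) (endograph v)

/-- The sendograph metric `H_send`. -/
def Hsend (u v : X → ℝ) : ℝ≥0∞ := HPdist (sendograph u) (sendograph v)

/-- Γ-convergence: Kuratowski convergence of the endographs in `X × [0,1]`. -/
def GammaConv (un : ℕ → X → ℝ) (u : X → ℝ) : Prop :=
  KurConv (fun n => endograph (un n)) (endograph u)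

/-- `P(u)`: the set of `α ∈ (0,1)` such that `closure {u > α}` is a proper subset of `[u]_α`. -/
def Pset (u : X → ℝ) : Set ℝ :=
  {α ∈ Ioo (0:ℝ) 1 | closure {x | α < u x} ⊂ acut u α}

/-- `D(u)`: the set of `α ∈ (0,1)` such that `[u]_α ⊄ closure {u > α}`. -/
def Dset (u : X → ℝ) : Set ℝ :=
  {α ∈ Ioo (0:ℝ) 1 | ¬ acut u α ⊆ closure {x | α < u x}}

/-- `P₀(u) = (0,1) \ {α ∈ (0,1) : lim_{β → α} H([u]_β , [u]_α) = 0}`. -/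
def P0set (u : X → ℝ) : Set ℝ :=
  Ioo (0:ℝ) 1 \
    {α | Tendsto (fun β => HXdist (acut u β) (acut u α)) (𝓝[Icc (0:ℝ) 1] α) (𝓝 0)}

/-- The `d_p^*` distance on fuzzy sets. -/
def dpstar (p : ℝ) (u v : X → ℝ) : ℝ≥0∞ :=
  ⨅ f ∈ {f : ℝ → ℝ≥0∞ | Measurable f ∧
      ∀ α ∈ Icc (0:ℝ) 1, HXdist (acut u α) (acut v α) ≤ f α},
    (∫⁻ α in Icc (0:ℝ) 1, f α ^ p) ^ (1 / p)

theorem mem_KurLiminf_iff {Y : Type*} [PseudoMetricSpace Y] {C : ℕ → Set Y}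
    (hC : ∀ n, (C n).Nonempty) {y : Y} :
    y ∈ KurLiminf C ↔ ∀ U ∈ 𝓝 y, ∀ᶠ n in atTop, (C n ∩ U).Nonempty := by
  constructor
  · rintro ⟨f, hf, hlim⟩ U hU
    filter_upwards [hlim hU] with n hn using ⟨f n, hf n, hn⟩
  · intro h
    have hnear : ∀ n : ℕ, ∃ z ∈ C n, dist y z < Metric.infDist y (C n) + 1 / ((n : ℝ) + 1) :=
      fun n => (Metric.infDist_lt_iff (hC n)).1 (lt_add_of_pos_right _ Nat.one_div_pos_of_nat)
    choose f hf hdist using hnear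
    refine ⟨f, hf, ?_⟩
    have hinf : Tendsto (fun n => Metric.infDist y (C n)) atTop (𝓝 0) := by
      rw [Metric.tendsto_nhds]
      intro ε hε
      filter_upwards [h _ (Metric.ball_mem_nhds y hε)] with n hn
      obtain ⟨z, hzC, hz⟩ := hn
      rw [Real.dist_eq, sub_zero, abs_of_nonneg Metric.infDist_nonneg]
      exact (Metric.infDist_le_dist_of_mem hzC).trans_lt (by rwa [dist_comm])
    have hbound := hinf.add (tendsto_one_div_add_atTop_nhds_zero_nat (𝕜 := ℝ))
    rw [add_zero] at hbound
    rw [tendsto_iff_dist_tendsto_zero]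
    refine squeeze_zero (fun _ => dist_nonneg) (fun n => ?_) hbound
    rw [dist_comm]
    exact (hdist n).le

theorem isClosed_KurLiminf {Y : Type*} [PseudoMetricSpace Y] {C : ℕ → Set Y}
    (hC : ∀ n, (C n).Nonempty) : IsClosed (KurLiminf C) := by
  refine isClosed_of_closure_subset fun y hy => (mem_KurLiminf_iff hC).2 fun U hU => ?_
  obtain ⟨V, hVU, hV, hyV⟩ := mem_nhds_iff.1 hU
  obtain ⟨z, hzV, hz⟩ := mem_closure_iff.1 hy V hV hyV
  filter_upwards [(mem_KurLiminf_iff hC).1 hz V (hV.mem_nhds hzV)] with n hn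
  exact hn.mono (inter_subset_inter_right _ hVU)

theorem KurLiminf_subset_KurLimsup {Y : Type*} [TopologicalSpace Y] (C : ℕ → Set Y) :
    KurLiminf C ⊆ KurLimsup C :=
  fun _ ⟨f, hf, hlim⟩ => ⟨id, strictMono_id, f, hf, hlim⟩

theorem kurConv_of_subset {Y : Type*} [TopologicalSpace Y] {C : ℕ → Set Y} {L : Set Y}
    (hinf : L ⊆ KurLiminf C) (hsup : KurLimsup C ⊆ L) : KurConv C L :=
  ⟨((KurLiminf_subset_KurLimsup C).trans hsup).antisymm hinf,
    hsup.antisymm (hinf.trans (KurLiminf_subset_KurLimsup C))⟩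

theorem mem_KurLimsup_of_eventually {Y : Type*} [TopologicalSpace Y] {C : ℕ → Set Y} {φ : ℕ → ℕ}
    (hφ : StrictMono φ) {f : ℕ → Y} (hf : ∀ᶠ k in atTop, f k ∈ C (φ k)) {y : Y}
    (hlim : Tendsto f atTop (𝓝 y)) : y ∈ KurLimsup C := by
  obtain ⟨N, hN⟩ := eventually_atTop.1 hf
  exact ⟨fun k => φ (k + N), fun a b hab => hφ (Nat.add_lt_add_right hab N),
    fun k => f (k + N), fun k => hN _ (Nat.le_add_left N k),
    hlim.comp (tendsto_add_atTop_nat N)⟩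

theorem mem_acut {u : X → ℝ} {α : ℝ} (hα : α ≠ 0) {x : X} : x ∈ acut u α ↔ α ≤ u x := by
  simp [acut, hα]

theorem acut_subset_closure_of_notMem_Pset {u : X → ℝ} (hu : FUSC u) {α : ℝ}
    (hα : α ∈ Ioo (0:ℝ) 1 \ Pset u) : acut u α ⊆ closure {x | α < u x} := by
  by_contra hnot
  refine hα.2 ⟨hα.1, closure_minimal (fun x hx => ?_)
    (hu.2 α (Ioo_subset_Icc_self hα.1)).2, hnot⟩
  exact (mem_acut hα.1.1.ne').2 (le_of_lt hx)

theorem countable_Pset {u : X → ℝ} (hsep : TopologicalSpace.IsSeparable (acut u 0)) :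
    (Pset u).Countable := by
  rcases isEmpty_or_nonempty X with hX | hX
  · refine countable_empty.mono ?_
    rintro α ⟨-, -, hα⟩
    exact hα fun x => hX.elim x
  obtain ⟨c, hc, hsub⟩ := hsep
  have hball : ∀ α ∈ Pset u, ∃ p : X × ℕ, p.1 ∈ c ∧
      (∃ x, u x = α ∧ dist x p.1 < 1 / ((p.2 : ℝ) + 1)) ∧
      ∀ y, dist y p.1 < 1 / ((p.2 : ℝ) + 1) → u y ≤ α := by
    rintro α ⟨⟨hα0, -⟩, -, hα⟩
    obtain ⟨x, hx, hxc⟩ := not_subset.1 hα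
    have hαx : α ≤ u x := (mem_acut hα0.ne').1 hx
    have hux : u x = α := (not_lt.1 fun h => hxc (subset_closure h)).antisymm hαx
    obtain ⟨ε, hε, hdisj⟩ := Metric.isOpen_iff.1 isClosed_closure.isOpen_compl x hxc
    obtain ⟨n, hn⟩ := exists_nat_one_div_lt (half_pos hε)
    have hx0 : x ∈ acut u 0 := by
      simp only [acut, if_true]
      exact subset_closure (hα0.trans_le hαx)
    obtain ⟨z, hz, hxz⟩ := Metric.mem_closure_iff.1 (hsub hx0) _ (Nat.one_div_pos_of_nat (n := n))
    refine ⟨(z, n), hz, ⟨x, hux, hxz⟩, fun y hy => not_lt.1 fun hlt => ?_⟩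
    refine hdisj (Metric.mem_ball.2 ?_) (subset_closure hlt)
    have := dist_triangle_right y x z
    simp only at hy
    linarith
  choose! p hpc hpx hpy using hball
  have hmaps : MapsTo p (Pset u) (c ×ˢ univ) := fun α hα => ⟨hpc α hα, mem_univ _⟩
  have hle : ∀ α ∈ Pset u, ∀ β ∈ Pset u, p α = p β → β ≤ α := by
    intro α hα β hβ h
    obtain ⟨x, hxβ, hx⟩ := hpx β hβ
    rw [← h] at hx
    exact hxβ ▸ hpy α hα x hx
  exact hmaps.countable_of_injOn
    (fun α hα β hβ h => (hle β hβ α hα h.symm).antisymm (hle α hα β hβ h))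
    (hc.prod countable_univ)

theorem GammaConv.kurConv_acut {u : X → ℝ} {un : ℕ → X → ℝ} (h : GammaConv un u) (hu : FUSC u)
    (hun : ∀ n, FUSC (un n)) {α : ℝ} (hα : α ∈ Ioo (0:ℝ) 1 \ Pset u) :
    KurConv (fun n => acut (un n) α) (acut u α) := by
  have hα0 : α ≠ 0 := hα.1.1.ne'
  have hαI : α ∈ Icc (0:ℝ) 1 := Ioo_subset_Icc_self hα.1
  have hne : ∀ n, (acut (un n) α).Nonempty := fun n => ((hun n).2 α hαI).1
  apply kurConv_of_subset
  · refine (acut_subset_closure_of_notMem_Pset hu hα).trans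
      (closure_minimal (fun z hz => ?_) (isClosed_KurLiminf hne))
    have hmem : (z, u z) ∈ KurLiminf fun n => endograph (un n) := by
      rw [h.1]
      exact ⟨hu.1 z, le_rfl⟩
    obtain ⟨f, hf, hlim⟩ := hmem
    refine (mem_KurLiminf_iff hne).2 fun U hU => ?_
    have hlim' := (Prod.tendsto_iff _ _).1 hlim
    filter_upwards [hlim'.1 hU, hlim'.2.eventually_const_lt hz] with n hnU hn
    exact ⟨(f n).1, (mem_acut hα0).2 (hn.le.trans (hf n).2), hnU⟩
  · rintro y ⟨φ, hφ, f, hf, hlim⟩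
    have hmem : (y, α) ∈ KurLimsup fun n => endograph (un n) :=
      ⟨φ, hφ, fun k => (f k, α), fun k => ⟨hαI, (mem_acut hα0).1 (hf k)⟩,
        hlim.prodMk_nhds tendsto_const_nhds⟩
    rw [h.2] at hmem
    exact (mem_acut hα0).2 hmem.2

theorem gammaConv_of_kurConv_acut {u : X → ℝ} {un : ℕ → X → ℝ} (hu : FUSC u)
    (hun : ∀ n, FUSC (un n))
    (h : ∀ a b : ℝ, 0 ≤ a → a < b → b ≤ 1 →
      ∃ β ∈ Ioo a b, KurConv (fun n => acut (un n) β) (acut u β)) :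
    GammaConv un u := by
  apply kurConv_of_subset
  · have hzero : ∀ x n, ((x, 0) : X × ℝ) ∈ endograph (un n) :=
      fun x n => ⟨⟨le_rfl, zero_le_one⟩, ((hun n).1 x).1⟩
    rintro ⟨x, t⟩ ⟨⟨ht0, ht1⟩, htx⟩
    simp only at ht0 ht1 htx
    refine (mem_KurLiminf_iff fun n => ⟨_, hzero x n⟩).2 fun U hU => ?_
    rcases ht0.eq_or_lt with rfl | ht0
    · exact Eventually.of_forall fun n => ⟨_, hzero x n, mem_of_mem_nhds hU⟩
    obtain ⟨V, hV, W, hW, hVW⟩ := mem_nhds_prod_iff.1 hU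
    obtain ⟨ε, hε, hball⟩ := Metric.mem_nhds_iff.1 hW
    obtain ⟨β, ⟨hβl, hβt⟩, hβ⟩ := h (max 0 (t - ε)) t (le_max_left _ _)
      (max_lt ht0 (sub_lt_self t hε)) ht1
    obtain ⟨hβ0, hβε⟩ := max_lt_iff.1 hβl
    have hx : x ∈ KurLiminf fun n => acut (un n) β := by
      rw [hβ.1]
      exact (mem_acut hβ0.ne').2 (hβt.le.trans htx)
    obtain ⟨f, hf, hlim⟩ := hx
    filter_upwards [hlim hV] with n hn
    refine ⟨(f n, β), ⟨⟨hβ0.le, hβt.le.trans ht1⟩, (mem_acut hβ0.ne').1 (hf n)⟩,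
      hVW ⟨hn, hball ?_⟩⟩
    rw [Metric.mem_ball, Real.dist_eq, abs_lt]
    constructor <;> linarith
  · rintro ⟨y, s⟩ ⟨φ, hφ, f, hf, hlim⟩
    have hlim' := (Prod.tendsto_iff _ _).1 hlim
    have hs : s ∈ Icc (0:ℝ) 1 :=
      isClosed_Icc.mem_of_tendsto hlim'.2 (Eventually.of_forall fun k => (hf k).1)
    refine ⟨hs, not_lt.1 fun hlt => ?_⟩
    obtain ⟨β, ⟨hyβ, hβs⟩, hβ⟩ := h (u y) s (hu.1 y).1 hlt hs.2
    have hβ0 : β ≠ 0 := ((hu.1 y).1.trans_lt hyβ).ne'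
    have hmem : y ∈ KurLimsup fun n => acut (un n) β := by
      refine mem_KurLimsup_of_eventually hφ ?_ hlim'.1
      filter_upwards [hlim'.2.eventually_const_lt hβs] with k hk
      exact (mem_acut hβ0).2 (hk.le.trans (hf k).2)
    rw [hβ.2] at hmem
    exact hyβ.not_ge ((mem_acut hβ0).1 hmem)

/-- level decomposition of Γ-convergence when `([u]_0, d)` is separable. -/
theorem stmt6 (u : X → ℝ) (un : ℕ → X → ℝ) (hu : FUSC u) (hun : ∀ n, FUSC (un n))
    (hsep : TopologicalSpace.IsSeparable (acut u 0)) :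
    List.TFAE
      [ GammaConv un u,
        ∀ᵐ α ∂(volume.restrict (Ioo (0:ℝ) 1)),
          KurConv (fun n => acut (un n) α) (acut u α),
        ∀ α ∈ Ioo (0:ℝ) 1 \ Pset u, KurConv (fun n => acut (un n) α) (acut u α),
        ∃ P : Set ℝ, DenseIn P (Ioo (0:ℝ) 1 \ Pset u) ∧
          ∀ α ∈ P, KurConv (fun n => acut (un n) α) (acut u α),
        ∃ P : Set ℝ, P.Countable ∧ DenseIn P (Ioo (0:ℝ) 1 \ Pset u) ∧
          ∀ α ∈ P, KurConv (fun n => acut (un n) α) (acut u α) ] := by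
  have hcount := countable_Pset hsep
  tfae_have 1 → 3 := fun h α hα => h.kurConv_acut hu hun hα
  tfae_have 3 → 2 := by
    intro h
    rw [ae_restrict_iff' measurableSet_Ioo]
    filter_upwards [hcount.ae_notMem volume] with α hα hmem using h α ⟨hmem, hα⟩
  tfae_have 2 → 1 := by
    intro h
    rw [ae_restrict_iff' measurableSet_Ioo] at h
    refine gammaConv_of_kurConv_acut hu hun fun a b ha hab hb => ?_
    obtain ⟨β, hβ, hconv⟩ := (Measure.dense_of_ae h).exists_mem_open isOpen_Ioo
      (nonempty_Ioo.2 hab)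
    exact ⟨β, hconv, hβ ⟨ha.trans_lt hconv.1, hconv.2.trans_le hb⟩⟩
  tfae_have 3 → 5 := by
    intro h
    obtain ⟨P, hPsub, hPc, hPd⟩ :=
      (TopologicalSpace.IsSeparable.of_separableSpace
        (Ioo (0:ℝ) 1 \ Pset u)).exists_countable_dense_subset
    exact ⟨P, hPc, ⟨hPsub, hPd⟩, fun α hα => h α (hPsub hα)⟩
  tfae_have 5 → 4 := fun ⟨P, _, hP, h⟩ => ⟨P, hP, h⟩
  tfae_have 4 → 1 := by
    rintro ⟨P, ⟨-, hdense⟩, h⟩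
    refine gammaConv_of_kurConv_acut hu hun fun a b ha hab hb => ?_
    obtain ⟨γ, hγP, hγ⟩ := (hcount.dense_compl ℝ).exists_mem_open isOpen_Ioo
      (nonempty_Ioo.2 hab)
    obtain ⟨β, hβ, hβP⟩ := mem_closure_iff.1
      (hdense ⟨⟨ha.trans_lt hγ.1, hγ.2.trans_le hb⟩, hγP⟩) _ isOpen_Ioo hγ
    exact ⟨β, hβ, h β hβP⟩
  tfae_finish

end
end

section
/- Let (X,d) be a metric space and let U ⊆ F¹_USCG(X). Then U is totally bounded in (F¹_USCG(X), H_end) if and only if U(α) = ∪_{u∈U} [u]_α is totally bounded in (X,d) for each α ∈ (0,1]. -/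
open Set Filter Topology MeasureTheory
open scoped ENNReal NNReal

noncomputable section

variable {X : Type*} [MetricSpace X]

theorem dbar_eq_ofReal (p q : X × ℝ) :
    dbar p q = ENNReal.ofReal (dist p.1 q.1 + dist p.2 q.2) := by
  rw [dbar, edist_dist, edist_dist, ENNReal.ofReal_add dist_nonneg dist_nonneg]

theorem exists_lt_of_hStar_lt {Y : Type*} {ρ : Y → Y → ℝ≥0∞} {A B : Set Y} {δ : ℝ≥0∞}
    (h : hStar ρ A B < δ) {a : Y} (ha : a ∈ A) : ∃ b ∈ B, ρ a b < δ := by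
  have h' : ⨅ b ∈ B, ρ a b < δ :=
    (le_iSup₂ (f := fun a (_ : a ∈ A) => ⨅ b ∈ B, ρ a b) a ha).trans_lt h
  simpa only [iInf_lt_iff, exists_prop] using h'

theorem hStar_le_of_forall_exists_le {Y : Type*} {ρ : Y → Y → ℝ≥0∞} {A B : Set Y} {δ : ℝ≥0∞}
    (h : ∀ a ∈ A, ∃ b ∈ B, ρ a b ≤ δ) : hStar ρ A B ≤ δ := by
  refine iSup₂_le fun a ha => ?_
  obtain ⟨b, hb, hab⟩ := h a ha
  exact (iInf₂_le b hb).trans hab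

theorem acut_of_ne_zero (u : X → ℝ) {α : ℝ} (hα : α ≠ 0) : acut u α = {x | α ≤ u x} :=
  if_neg hα

/-- Endograph approximations at scale `δ < α` move points of `[u]_α` into `[v]_(α - δ)`. -/
theorem exists_dist_lt_of_Hend_lt {u v : X → ℝ} {δ α : ℝ} (hα : α ∈ Ioc (0 : ℝ) 1)
    (h : Hend u v < ENNReal.ofReal δ) {x : X} (hx : α ≤ u x) :
    ∃ y, α - δ ≤ v y ∧ dist x y < δ := by
  obtain ⟨⟨y, β⟩, ⟨-, hβ⟩, hd⟩ := exists_lt_of_hStar_lt ((le_max_left _ _).trans_lt h)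
    (show (x, α) ∈ endograph u from ⟨⟨hα.1.le, hα.2⟩, hx⟩)
  rw [dbar_eq_ofReal, ENNReal.ofReal_lt_ofReal_iff_of_nonneg (by positivity)] at hd
  simp only [Real.dist_eq] at hd hβ
  have h₁ := le_abs_self (α - β)
  have h₂ := abs_nonneg (α - β)
  have h₃ := dist_nonneg (x := x) (y := y)
  exact ⟨y, by linarith, by linarith⟩

/-- The grid cells met by the cuts of `u`: the pairs `(k, y)`, with `1 ≤ k ≤ n` and `y ∈ t`,
such that `[u]_(k/n)` meets the ball of radius `δ` around `y`. -/
def gridTrace (n : ℕ) (t : Set X) (δ : ℝ) (u : X → ℝ) : Set (ℕ × X) :=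
  {p ∈ Icc 1 n ×ˢ t | ∃ x, (p.1 : ℝ) / n ≤ u x ∧ dist x p.2 < δ}

theorem hStar_endograph_le_of_gridTrace_subset {n : ℕ} (hn : 0 < n) {t : Set X} {δ : ℝ}
    (hδ : 1 / (n : ℝ) < δ) {u v : X → ℝ} (hv : ∀ x, 0 ≤ v x)
    (ht : ∀ x, 1 / (n : ℝ) ≤ u x → ∃ y ∈ t, dist x y < δ)
    (h : gridTrace n t δ u ⊆ gridTrace n t δ v) :
    HPstar (endograph u) (endograph v) ≤ ENNReal.ofReal (3 * δ) := by
  have hn' : (0 : ℝ) < n := by exact_mod_cast hn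
  have hδ₀ : 0 < δ := lt_trans (by positivity) hδ
  refine hStar_le_of_forall_exists_le ?_
  rintro ⟨x, a⟩ ⟨⟨ha₀, ha₁⟩, hax⟩
  simp only at ha₀ ha₁ hax
  by_cases ha : a < 1 / n
  · refine ⟨(x, 0), ⟨by simp, hv x⟩, ?_⟩
    rw [dbar_eq_ofReal]
    refine ENNReal.ofReal_le_ofReal ?_
    simp only [dist_self, Real.dist_eq, sub_zero, abs_of_nonneg ha₀]
    linarith
  · push Not at ha
    have hk₁ : 1 ≤ ⌊a * n⌋₊ := Nat.le_floor (by rw [div_le_iff₀ hn'] at ha; simpa using ha)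
    have hkn : ⌊a * n⌋₊ ≤ n :=
      Nat.floor_le_of_le (by nlinarith)
    have hka : (⌊a * n⌋₊ : ℝ) / n ≤ a := by
      rw [div_le_iff₀ hn']
      exact Nat.floor_le (by positivity)
    have hak : a < (⌊a * n⌋₊ : ℝ) / n + 1 / n := by
      rw [← add_div, lt_div_iff₀ hn']
      exact Nat.lt_floor_add_one _
    obtain ⟨y, hy, hxy⟩ := ht x (ha.trans hax)
    obtain ⟨-, z, hz, hzy⟩ := h (show (⌊a * n⌋₊, y) ∈ gridTrace n t δ u from
      ⟨⟨⟨hk₁, hkn⟩, hy⟩, x, hka.trans hax, hxy⟩)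
    refine ⟨(z, (⌊a * n⌋₊ : ℝ) / n), ⟨⟨by positivity, hka.trans ha₁⟩, hz⟩, ?_⟩
    rw [dbar_eq_ofReal]
    refine ENNReal.ofReal_le_ofReal ?_
    simp only [Real.dist_eq] at hzy ⊢
    rw [abs_of_nonneg (sub_nonneg.2 hka)]
    have := dist_triangle_right x z y
    linarith

theorem totallyBounded_iUnion_acut {U : Set (X → ℝ)} (hU : ∀ u ∈ U, FUSCG u)
    (h : ∀ ε : ℝ≥0∞, 0 < ε → ∃ V ⊆ U, V.Finite ∧ ∀ u ∈ U, ∃ v ∈ V, Hend u v < ε)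
    {α : ℝ} (hα : α ∈ Ioc (0 : ℝ) 1) : TotallyBounded (⋃ u ∈ U, acut u α) := by
  refine Metric.totallyBounded_iff.2 fun ε hε => ?_
  obtain ⟨δ, hδ₀, hδ⟩ : ∃ δ, 0 < δ ∧ δ < min (ε / 2) α :=
    exists_between (lt_min (half_pos hε) hα.1)
  obtain ⟨hδε, hδα⟩ := lt_min_iff.1 hδ
  obtain ⟨V, hVU, hVfin, hV⟩ := h (ENNReal.ofReal δ) (ENNReal.ofReal_pos.2 hδ₀)
  have hK : IsCompact (⋃ v ∈ V, acut v (α - δ)) :=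
    hVfin.isCompact_biUnion fun v hv =>
      (hU v (hVU hv)).2 _ ⟨sub_pos.2 hδα, by linarith [hα.2]⟩
  obtain ⟨t, ht, hcov⟩ := Metric.totallyBounded_iff.1 hK.totallyBounded (ε / 2) (half_pos hε)
  refine ⟨t, ht, ?_⟩
  simp only [iUnion_subset_iff, acut_of_ne_zero _ hα.1.ne']
  intro u hu x hx
  obtain ⟨v, hv, huv⟩ := hV u hu
  obtain ⟨y, hy, hxy⟩ := exists_dist_lt_of_Hend_lt hα huv hx
  have hyK : y ∈ ⋃ v ∈ V, acut v (α - δ) := by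
    refine mem_biUnion hv ?_
    rwa [acut_of_ne_zero _ (sub_pos.2 hδα).ne']
  obtain ⟨z, hz, hyz⟩ := mem_iUnion₂.1 (hcov hyK)
  refine mem_iUnion₂.2 ⟨z, hz, ?_⟩
  rw [Metric.mem_ball] at hyz ⊢
  linarith [dist_triangle x y z]

theorem exists_finite_Hend_approximation {U : Set (X → ℝ)} (hU : ∀ u ∈ U, ∀ x, 0 ≤ u x)
    (h : ∀ α ∈ Ioc (0 : ℝ) 1, TotallyBounded (⋃ u ∈ U, acut u α)) {ε : ℝ≥0∞} (hε : 0 < ε) :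
    ∃ V ⊆ U, V.Finite ∧ ∀ u ∈ U, ∃ v ∈ V, Hend u v < ε := by
  obtain ⟨r, hr₀, hr⟩ := ENNReal.lt_iff_exists_nnreal_btwn.1 hε
  have hδ₀ : (0 : ℝ) < r / 3 := div_pos (by exact_mod_cast hr₀) three_pos
  obtain ⟨m, hm⟩ := exists_nat_one_div_lt hδ₀
  have hn : 1 / ((m + 1 : ℕ) : ℝ) < r / 3 := by exact_mod_cast hm
  have hn₀ : (0 : ℝ) < 1 / ((m + 1 : ℕ) : ℝ) := by positivity
  have hn₁ : 1 / ((m + 1 : ℕ) : ℝ) ≤ 1 := by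
    rw [div_le_one (by positivity)]
    exact_mod_cast m.succ_pos
  obtain ⟨t, htfin, hcov⟩ := Metric.totallyBounded_iff.1 (h _ ⟨hn₀, hn₁⟩) _ hδ₀
  have ht : ∀ u ∈ U, ∀ x, 1 / ((m + 1 : ℕ) : ℝ) ≤ u x → ∃ y ∈ t, dist x y < r / 3 := by
    intro u hu x hx
    have hxU : x ∈ ⋃ u ∈ U, acut u (1 / ((m + 1 : ℕ) : ℝ)) := by
      refine mem_biUnion hu ?_
      rwa [acut_of_ne_zero _ hn₀.ne']
    simpa using hcov hxU
  obtain ⟨V, hVU, hV⟩ := exists_subset_bijOn U (gridTrace (m + 1) t (r / 3))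
  have himg : (gridTrace (m + 1) t (r / 3) '' U).Finite := by
    refine (((finite_Icc 1 (m + 1)).prod htfin).finite_subsets).subset ?_
    rintro _ ⟨u, -, rfl⟩
    exact sep_subset _ _
  refine ⟨V, hVU, hV.finite_iff_finite.2 himg, fun u hu => ?_⟩
  obtain ⟨v, hv, hvu⟩ := hV.surjOn (mem_image_of_mem _ hu)
  refine ⟨v, hv, lt_of_le_of_lt (max_le
    (hStar_endograph_le_of_gridTrace_subset m.succ_pos hn (hU v (hVU hv)) (ht u hu) hvu.ge)
    (hStar_endograph_le_of_gridTrace_subset m.succ_pos hn (hU u hu) (ht v (hVU hv)) hvu.le)) ?_⟩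
  rwa [mul_div_cancel₀ _ three_ne_zero, ENNReal.ofReal_coe_nnreal]

/-- `U ⊆ F¹_USCG(X)` is totally bounded in `(F¹_USCG(X), H_end)` (i.e. for
every `ε > 0` it has a finite `ε`-approximation) iff each `U(α)`, `α ∈ (0,1]`, is totally
bounded in `X`. -/
theorem stmt16 (U : Set (X → ℝ)) (hU : ∀ u ∈ U, FUSCG u) :
    (∀ ε : ℝ≥0∞, 0 < ε → ∃ V ⊆ U, V.Finite ∧ ∀ u ∈ U, ∃ v ∈ V, Hend u v < ε) ↔
      ∀ α ∈ Ioc (0:ℝ) 1, TotallyBounded (⋃ u ∈ U, acut u α) := by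
  exact ⟨fun h _ hα => totallyBounded_iUnion_acut hU h hα,
    fun h _ hε => exists_finite_Hend_approximation (fun u hu x => ((hU u hu).1.1 x).1) h hε⟩

end
end
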